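/- arXiv:1308.0557 — 3 statements merged into one kernel-verified Lean document; each statement's English description precedes it below -/
import Mathlib

section
/- Let V be a complex vector space, let L, H : ℤ → End(V) be families of linear endomorphisms of V, and let c, α, β ∈ ℂ be constants such that for all m, n ∈ ℤ: (i) [L(m), L(n)] = (m−n)·L(m+n) + ((m³−m)/12)·c·δ_{m+n,0}·Id; (ii) [L(m), H(n)] = −n·H(m+n) + ((m²+m)/2)·β·δ_{m+n,0}·Id; (iii) [H(m), H(n)] = m·α·δ_{m+n,0}·Id. Define L_h(n) = L(n) − (n+1)·H(n) for each n ∈ ℤ. Then for all m, n ∈ ℤ one has [L_h(m), L_h(n)] = (m−n)·L_h(m+n) + ((m³−m)/12)·(c + 12(β−α))·δ_{m+n,0}·Id; that is, the operators L_h(n) satisfy the Virasoro commutation relations with central charge c + 12(β−α). -/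
/-- Virasoro relations for the deformed modes `L_h(n) = L(n) - (n+1) H(n)`,
with deformed central charge `c + 12(β - α)`. -/
theorem deformed_virasoro
    (V : Type*) [AddCommGroup V] [Module ℂ V]
    (L H : ℤ → Module.End ℂ V) (c α β : ℂ)
    (hLL : ∀ m n : ℤ, ⁅L m, L n⁆ =
      ((m : ℂ) - (n : ℂ)) • L (m + n) +
        ((((m : ℂ) ^ 3 - (m : ℂ)) / 12) * c *
          (if m + n = 0 then 1 else 0)) • (1 : Module.End ℂ V))
    (hLH : ∀ m n : ℤ, ⁅L m, H n⁆ =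
      (-(n : ℂ)) • H (m + n) +
        ((((m : ℂ) ^ 2 + (m : ℂ)) / 2) * β *
          (if m + n = 0 then 1 else 0)) • (1 : Module.End ℂ V))
    (hHH : ∀ m n : ℤ, ⁅H m, H n⁆ =
      ((m : ℂ) * α * (if m + n = 0 then 1 else 0)) • (1 : Module.End ℂ V))
    (Lh : ℤ → Module.End ℂ V)
    (hLh : ∀ n : ℤ, Lh n = L n - ((n : ℂ) + 1) • H n) :
    ∀ m n : ℤ, ⁅Lh m, Lh n⁆ =
      ((m : ℂ) - (n : ℂ)) • Lh (m + n) +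
        ((((m : ℂ) ^ 3 - (m : ℂ)) / 12) * (c + 12 * (β - α)) *
          (if m + n = 0 then 1 else 0)) • (1 : Module.End ℂ V) := by
  intro m n
  have expand : ⁅Lh m, Lh n⁆ = ⁅L m, L n⁆ - ((n : ℂ) + 1) • ⁅L m, H n⁆
      + ((m : ℂ) + 1) • ⁅L n, H m⁆ + (((m : ℂ) + 1) * ((n : ℂ) + 1)) • ⁅H m, H n⁆ := by
    simp only [hLh, Ring.lie_def, sub_mul, mul_sub, smul_mul_assoc, mul_smul_comm]
    module
  rw [expand, hLL, hLH, hLH, hHH, hLh, add_comm n m]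
  split_ifs with h
  · obtain rfl : n = -m := by lia
    push_cast
    module
  · push_cast
    module
end

section
/- Let m, c, r be real numbers with m > 0. If r² > m² + 4·m·c, then there exists an integer u such that c + r·u + m·u² < 0. -/
/-- A quadratic `c + r·x + m·x²` with positive leading coefficient `m` takes a negative
value at some integer whenever `r² > m² + 4·m·c` (its roots are more than one unit
apart). -/
theorem quadratic_neg_at_integer (m c r : ℝ) (hm : 0 < m)
    (h : r ^ 2 > m ^ 2 + 4 * m * c) :
    ∃ u : ℤ, c + r * (u : ℝ) + m * (u : ℝ) ^ 2 < 0 := by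
  have hround : |-r / (2 * m) - round (-r / (2 * m))| ≤ 1 / 2 := abs_sub_round _
  set u : ℤ := round (-r / (2 * m))
  refine ⟨u, ?_⟩
  have hvertex : 2 * m * u + r = -(2 * m) * (-r / (2 * m) - u) := by
    field_simp
    ring
  have hsq : (2 * m * u + r) ^ 2 ≤ m ^ 2 := by
    rw [sq_le_sq, hvertex, abs_mul, abs_neg, abs_of_pos (by positivity : 0 < 2 * m),
      abs_of_pos hm]
    nlinarith
  have hneg : 4 * m * (c + r * u + m * (u : ℝ) ^ 2) < 0 := by linarith
  exact neg_of_mul_neg_right hneg (by positivity)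
end

section
/- Let I be a nonempty finite index set, let s : I → ℝ, let m be a positive integer, and let c : I × ℝ × ℤ → ℂ be a family of coefficients, written c_i(x, r), such that c_i(x, r) = 0 whenever x < 0. Suppose that for every integer u and every i ∈ I there exists i' ∈ I such that for all x ∈ ℝ and r ∈ ℤ: c_{i'}(x + r·u + m·u² + s_i − s_{i'}, r + 2·u·m) = c_i(x, r). For each i ∈ I set d_i = max_{j∈I} |s_i − s_j|. Then for every i ∈ I, x ∈ ℝ and r ∈ ℤ, one has c_i(x, r) = 0 whenever r² > m² + 4·m·(x + d_i). -/
/-- Every integer is congruent modulo `2 * m` to an integer of absolute value at most `m`. -/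
theorem exists_sq_add_two_mul_le (m : ℕ) (hm : 0 < m) (r : ℤ) :
    ∃ u : ℤ, ((r : ℝ) + 2 * u * m) ^ 2 ≤ (m : ℝ) ^ 2 := by
  have hm' : (0 : ℝ) < m := by exact_mod_cast hm
  refine ⟨round (-(r : ℝ) / (2 * m)), sq_le_sq.mpr ?_⟩
  have h := abs_sub_round (-(r : ℝ) / (2 * m))
  set u := round (-(r : ℝ) / (2 * m))
  have e : (r : ℝ) + 2 * u * m = -(2 * m) * (-(r : ℝ) / (2 * m) - u) := by
    field_simp
    ring
  rw [e, abs_mul, abs_neg, abs_of_pos (by positivity : (0 : ℝ) < 2 * m), abs_of_pos hm']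
  nlinarith

/-- Abstract form of Proposition 4.7: coefficients `c i (x, r)` supported on `x ≥ 0`
and satisfying the elliptic transformation identity vanish whenever
`r² > m² + 4·m·(x + d i)`, where `d i = max_j |s i - s j|`. -/
theorem coeff_vanishing_of_elliptic_transform
    (I : Type*) [Fintype I] [Nonempty I]
    (s : I → ℝ) (m : ℕ) (hm : 0 < m)
    (c : I → ℝ → ℤ → ℂ)
    (hsupp : ∀ (i : I) (x : ℝ) (r : ℤ), x < 0 → c i x r = 0)
    (htrans : ∀ (u : ℤ) (i : I), ∃ i' : I, ∀ (x : ℝ) (r : ℤ),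
      c i' (x + (r : ℝ) * (u : ℝ) + (m : ℝ) * (u : ℝ) ^ 2 + s i - s i')
          (r + 2 * u * (m : ℤ)) = c i x r) :
    ∀ (i : I) (x : ℝ) (r : ℤ),
      (r : ℝ) ^ 2 >
        (m : ℝ) ^ 2 + 4 * (m : ℝ) * (x + Finset.univ.sup' Finset.univ_nonempty
          (fun j => |s i - s j|)) →
      c i x r = 0 := by
  intro i x r hr
  have hm' : (0 : ℝ) < m := by exact_mod_cast hm
  obtain ⟨u, hu⟩ := exists_sq_add_two_mul_le m hm r
  obtain ⟨i', hi'⟩ := htrans u i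
  rw [← hi' x r]
  apply hsupp
  have hd := Finset.le_sup' (fun j => |s i - s j|) (Finset.mem_univ i')
  have hs := (le_abs_self (s i - s i')).trans hd
  set d := Finset.univ.sup' Finset.univ_nonempty (fun j => |s i - s j|)
  have key : (m : ℝ) * (x + r * u + m * u ^ 2 + d) < 0 := by nlinarith
  have := neg_of_mul_neg_right key hm'.le
  linarith
end
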